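/- In a free N-pseudospace, let a,…,x,…,b be a zigzag having x among its terms and let x,y,…,c be a zigzag starting at x. Then y,…,c is a final segment of a zigzag from a to c, or a final segment of a zigzag from b to c. -/

import Mathlib

/-- A *zigzag* of length `n`: consecutive terms are strictly comparable and every
interior term is either the infimum (a sink) or the supremum (a peak) of its two
neighbours. -/
def IsZigzag {V : Type*} [Lattice V] (x : ℕ → V) (n : ℕ) : Prop :=
  (∀ i < n, x i < x (i + 1) ∨ x (i + 1) < x i) ∧
  ∀ i, i + 2 ≤ n →
    (x (i + 1) < x i ∧ x (i + 1) < x (i + 2) ∧ x (i + 1) = x i ⊓ x (i + 2)) ∨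
    (x i < x (i + 1) ∧ x (i + 2) < x (i + 1) ∧ x (i + 1) = x i ⊔ x (i + 2))

/-- A *zigzag cycle* of length `2 * n`: a `2 * n`-periodic sequence satisfying the
zigzag condition at every index (i.e. indices modulo `2 * n`). -/
def IsZigzagCycle {V : Type*} [Lattice V] (x : ℕ → V) (n : ℕ) : Prop :=
  0 < n ∧ (∀ i, x (i + 2 * n) = x i) ∧
  ∀ i,
    (x (i + 1) < x i ∧ x (i + 1) < x (i + 2) ∧ x (i + 1) = x i ⊓ x (i + 2)) ∨
    (x i < x (i + 1) ∧ x (i + 2) < x (i + 1) ∧ x (i + 1) = x i ⊔ x (i + 2))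

/-- A lattice is *simply connected* if it contains no zigzag cycles. -/
def SimplyConnected (V : Type*) [Lattice V] : Prop :=
  ∀ (x : ℕ → V) (n : ℕ), ¬IsZigzagCycle x n

/-- A *free N-pseudospace* structure on a bounded lattice `M`: an `N`-geometry
(layers indexed by `-1, …, N+1` via the function `layer`, strictly monotone,
with `⊥` in layer `-1` and `⊤` in layer `N+1`) which is simply connected and such
that for all `a < b` and every layer index `s` strictly between the layers of `a`
and `b` there are infinitely many `x` in layer `s` with `a < x < b`. -/
structure FreePseudospace (N : ℕ) (M : Type*) [Lattice M] [BoundedOrder M] where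
  layer : M → ℤ
  layer_bot : layer ⊥ = -1
  layer_top : layer ⊤ = (N : ℤ) + 1
  layer_bounds : ∀ v : M, -1 ≤ layer v ∧ layer v ≤ (N : ℤ) + 1
  layer_strictMono : ∀ v w : M, v < w → layer v < layer w
  simplyConnected : SimplyConnected M
  dense_layers : ∀ a b : M, a < b → ∀ s : ℤ, layer a < s → s < layer b →
    {x : M | a < x ∧ x < b ∧ layer x = s}.Infinite

/-- A subset `A` is *closed* if it contains `⊥` and `⊤` and every zigzag whose two
endpoints lie in `A` lies entirely in `A`. -/
def ZClosed {M : Type*} [Lattice M] [BoundedOrder M] (A : Set M) : Prop :=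
  ⊥ ∈ A ∧ ⊤ ∈ A ∧
  ∀ (x : ℕ → M) (n : ℕ), IsZigzag x n → x 0 ∈ A → x n ∈ A → ∀ i ≤ n, x i ∈ A

/-- A *direct path* from `x 0` to `A`: a zigzag `x 0, …, x n` with `x i ∉ A` for
`i < n`, `x n ∈ A`, and no element of `A` strictly between `x (n-1)` and `x n`. -/
def IsDirectPath {M : Type*} [Lattice M] (x : ℕ → M) (n : ℕ) (A : Set M) : Prop :=
  IsZigzag x n ∧ (∀ i < n, x i ∉ A) ∧ x n ∈ A ∧
  ∀ y ∈ A, ¬((x (n - 1) < y ∧ y < x n) ∨ (x n < y ∧ y < x (n - 1)))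

section Zigzag

variable {V : Type*} [Lattice V]

/-- Three consecutive terms of a zigzag: the middle one is the infimum or the supremum of
the outer ones. -/
def IsTurn (a b c : V) : Prop :=
  (b < a ∧ b < c ∧ b = a ⊓ c) ∨ (a < b ∧ c < b ∧ b = a ⊔ c)

theorem IsTurn.symm {a b c : V} (h : IsTurn a b c) : IsTurn c b a := by
  rcases h with ⟨h₁, h₂, h₃⟩ | ⟨h₁, h₂, h₃⟩
  · exact Or.inl ⟨h₂, h₁, by rw [inf_comm]; exact h₃⟩
  · exact Or.inr ⟨h₂, h₁, by rw [sup_comm]; exact h₃⟩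

theorem IsZigzag.mono {p : ℕ → V} {m n : ℕ} (hp : IsZigzag p m) (h : n ≤ m) :
    IsZigzag p n :=
  ⟨fun i hi => hp.1 i (by omega), fun i hi => hp.2 i (by omega)⟩

theorem IsZigzag.reverse {p : ℕ → V} {m : ℕ} (hp : IsZigzag p m) :
    IsZigzag (fun i => p (m - i)) m := by
  refine ⟨fun i hi => ?_, fun i hi => ?_⟩
  · obtain ⟨d, rfl⟩ : ∃ d, m = i + 1 + d := ⟨m - (i + 1), by omega⟩
    have h := hp.1 d (by omega)
    simp only [show i + 1 + d - i = d + 1 by omega, show i + 1 + d - (i + 1) = d by omega]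
    exact h.symm
  · obtain ⟨d, rfl⟩ : ∃ d, m = i + 2 + d := ⟨m - (i + 2), by omega⟩
    have h : IsTurn _ _ _ := hp.2 d (by omega)
    simp only [show i + 2 + d - i = d + 2 by omega, show i + 2 + d - (i + 1) = d + 1 by omega,
      show i + 2 + d - (i + 2) = d by omega]
    exact h.symm

theorem IsZigzag.tail {q : ℕ → V} {k : ℕ} (hq : IsZigzag q (k + 1)) :
    IsZigzag (fun i => q (i + 1)) k :=
  ⟨fun i hi => hq.1 (i + 1) (by omega), fun i hi => hq.2 (i + 1) (by omega)⟩

/-- The sequence `c, q 0, q 1, …`. -/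
def consSeq (c : V) (q : ℕ → V) : ℕ → V
  | 0 => c
  | i + 1 => q i

theorem IsZigzag.cons {q : ℕ → V} {k : ℕ} (hq : IsZigzag q k) {c : V}
    (hc : c < q 0 ∨ q 0 < c) (h : 1 ≤ k → IsTurn c (q 0) (q 1)) :
    IsZigzag (consSeq c q) (k + 1) := by
  refine ⟨fun i hi => ?_, fun i hi => ?_⟩
  · cases i with
    | zero => exact hc
    | succ i => exact hq.1 i (by omega)
  · cases i with
    | zero => exact h (by omega)
    | succ i => exact hq.2 i (by omega)

theorem IsZigzag.append {p q : ℕ → V} {n k : ℕ} (hp : IsZigzag p n) (hq : IsZigzag q k)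
    (h₀ : p n = q 0) (h : 1 ≤ n → 1 ≤ k → IsTurn (p (n - 1)) (q 0) (q 1)) :
    IsZigzag (fun i => if i < n then p i else q (i - n)) (n + k) := by
  have e : ∀ i ≤ n, (if i < n then p i else q (i - n)) = p i := by
    intro i hi
    split_ifs with h'
    · rfl
    · obtain rfl : i = n := by omega
      simp [h₀]
  have e' : ∀ i, (if n + i < n then p (n + i) else q (n + i - n)) = q i := by
    intro i
    simp
  refine ⟨fun i hi => ?_, fun i hi => ?_⟩
  · rcases lt_or_ge i n with hin | hin
    · simp only [e i hin.le, e (i + 1) hin]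
      exact hp.1 i hin
    · obtain ⟨d, rfl⟩ := Nat.exists_eq_add_of_le hin
      simp only [add_assoc, e']
      exact hq.1 d (by omega)
  · rcases lt_or_ge i n with hin | hin
    · rcases Nat.lt_or_ge (i + 1) n with hin' | hin'
      · simp only [e i hin.le, e (i + 1) hin, e (i + 2) hin']
        exact hp.2 i hin'
      · obtain rfl : n = i + 1 := by omega
        have h₂ := e' 1
        have h₁ := e' 0
        have h' := h (by omega) (by omega)
        simp only [e i hin.le]
        rw [show i + 2 = i + 1 + 1 from rfl, h₂]
        rw [add_zero] at h₁
        rw [h₁]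
        exact h'
    · obtain ⟨d, rfl⟩ := Nat.exists_eq_add_of_le hin
      simp only [add_assoc, e']
      exact hq.2 d (by omega)

theorem IsZigzag.dual {p : ℕ → V} {n : ℕ} (hp : IsZigzag p n) :
    IsZigzag (V := Vᵒᵈ) p n :=
  ⟨fun i hi => (hp.1 i hi).symm, fun i hi => (hp.2 i hi).symm⟩

theorem SimplyConnected.dual (h : SimplyConnected V) : SimplyConnected Vᵒᵈ :=
  fun x n hx => h x n ⟨hx.1, hx.2.1, fun i => (hx.2.2 i).symm⟩

theorem IsZigzag.shift {q : ℕ → V} {k : ℕ} (d : ℕ) (hq : IsZigzag q (d + k)) :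
    IsZigzag (fun i => q (d + i)) k :=
  ⟨fun i hi => hq.1 (d + i) (by omega), fun i hi => hq.2 (d + i) (by omega)⟩

theorem IsZigzag.turn {p : ℕ → V} {m : ℕ} (hp : IsZigzag p m) {i : ℕ} (hi : i + 2 ≤ m) :
    IsTurn (p i) (p (i + 1)) (p (i + 2)) :=
  hp.2 i hi

theorem IsTurn.peak_left {a b c : V} (h : IsTurn a b c) (hab : a < b) : c < b ∧ b = a ⊔ c :=
  (h.resolve_left fun h' => h'.1.not_gt hab).2

theorem IsTurn.sink_left {a b c : V} (h : IsTurn a b c) (hab : b < a) : b < c ∧ b = a ⊓ c :=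
  (h.resolve_right fun h' => h'.1.not_gt hab).2

theorem IsTurn.peak_right {a b c : V} (h : IsTurn a b c) (hcb : c < b) : a < b ∧ b = a ⊔ c :=
  have h' := h.resolve_left fun h' => h'.2.1.not_gt hcb
  ⟨h'.1, h'.2.2⟩

theorem IsTurn.sink_right {a b c : V} (h : IsTurn a b c) (hcb : b < c) : b < a ∧ b = a ⊓ c :=
  have h' := h.resolve_right fun h' => h'.2.1.not_gt hcb
  ⟨h'.1, h'.2.2⟩

theorem IsZigzag.alternate {p : ℕ → V} {n : ℕ} (hp : IsZigzag p n) (h : p 0 < p 1) (i : ℕ)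
    (hi : i < n) : (Even i → p i < p (i + 1)) ∧ (¬ Even i → p (i + 1) < p i) := by
  induction i with
  | zero => exact ⟨fun _ => h, fun h' => absurd Even.zero h'⟩
  | succ i ih =>
    obtain ⟨h₁, h₂⟩ := ih (by omega)
    have turn := hp.turn (i := i) (by omega)
    rw [Nat.even_add_one, not_not]
    exact ⟨fun h' => (turn.sink_left (h₂ h')).1, fun h' => (turn.peak_left (h₁ h')).1⟩

/-- In a simply connected lattice, the endpoints of a zigzag of length at least two are
incomparable. -/
theorem SimplyConnected.not_le_of_isZigzag (h : SimplyConnected V) {p : ℕ → V} {n : ℕ}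
    (hp : IsZigzag p n) (hn : 2 ≤ n) : ¬ p 0 ≤ p n := by
  induction n using Nat.strong_induction_on generalizing p with
  | _ n ih =>
  intro hle
  obtain ⟨n, rfl⟩ : ∃ d, n = d + 2 := ⟨n - 2, by omega⟩
  rcases n with _ | n
  · rcases hp.turn (i := 0) (by omega) with ⟨h₁, -, h₂⟩ | ⟨-, h₁, h₂⟩
    · exact h₁.ne (h₂.trans (inf_eq_left.2 hle))
    · exact h₁.ne (h₂.trans (sup_eq_right.2 hle)).symm
  have tail : ¬ p 1 ≤ p (n + 3) := ih (n + 2) (by omega) hp.tail (by omega)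
  have initial : ¬ p 0 ≤ p (n + 2) := ih (n + 2) (by omega) (hp.mono (by omega)) (by omega)
  have up : p 0 < p 1 := (hp.1 0 (by omega)).resolve_right fun h' => tail (h'.le.trans hle)
  have up' : p (n + 2) < p (n + 3) :=
    (hp.1 (n + 2) (by omega)).resolve_right fun h' => initial (hle.trans h'.le)
  have parity : Even n := by
    by_contra hodd
    refine up'.not_gt ((hp.alternate up (n + 2) (by omega)).2 fun he => hodd ?_)
    simpa [Nat.even_add] using he
  have middle : ¬ p (n + 2) ≤ p 1 := by
    rcases n with _ | n
    · have e := ((hp.turn (i := 1) (by omega)).sink_right up').2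
      have le : p 0 ≤ p 2 := e ▸ le_inf up.le hle
      exact absurd le initial
    · have := ih (n + 2) (by omega) ((hp.mono (by omega)).shift (k := n + 2) 1).reverse
        (by omega)
      simpa [show 1 + (n + 2) = n + 3 by omega] using this
  have x₁ : p 1 ⊓ p (n + 3) < p 1 := inf_lt_left.2 tail
  have x₀ : p 0 ≤ p 1 ⊓ p (n + 3) := le_inf up.le hle
  have y₁ : p (n + 2) ⊔ p 1 ⊓ p (n + 3) ≤ p (n + 3) := sup_le up'.le inf_le_right
  have y₂ : p (n + 2) < p (n + 2) ⊔ p 1 ⊓ p (n + 3) :=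
    left_lt_sup.2 fun h' => initial (x₀.trans h')
  have y₃ : p 1 ⊓ p (n + 3) < p (n + 2) ⊔ p 1 ⊓ p (n + 3) :=
    right_lt_sup.2 fun h' => middle (h'.trans inf_le_left)
  have t_peak : IsTurn (p 1 ⊓ p (n + 3)) (p 1) (p 2) := by
    obtain ⟨h₁, h₂⟩ := (hp.turn (i := 0) (by omega)).peak_left up
    exact Or.inr ⟨x₁, h₁, le_antisymm (h₂.le.trans (sup_le_sup_right x₀ _)) (sup_le x₁.le h₁.le)⟩
  have t_sink : IsTurn (p (n + 1)) (p (n + 2)) (p (n + 2) ⊔ p 1 ⊓ p (n + 3)) := by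
    obtain ⟨h₁, h₂⟩ := (hp.turn (i := n + 1) (by omega)).sink_right up'
    exact Or.inl ⟨h₁, y₂, le_antisymm (le_inf h₁.le y₂.le)
      ((inf_le_inf_left _ y₁).trans h₂.ge)⟩
  have t_last : IsTurn (p (n + 2)) (p (n + 2) ⊔ p 1 ⊓ p (n + 3)) (p 1 ⊓ p (n + 3)) :=
    Or.inr ⟨y₂, y₃, rfl⟩
  have t_first : IsTurn (p (n + 2) ⊔ p 1 ⊓ p (n + 3)) (p 1 ⊓ p (n + 3)) (p 1) :=
    Or.inl ⟨y₃, x₁, le_antisymm (le_inf y₃.le inf_le_left)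
      (le_inf inf_le_right (inf_le_left.trans y₁))⟩
  obtain ⟨k, hk⟩ := parity
  let g : ℕ → V := fun i =>
    if i = 0 then p 1 ⊓ p (n + 3) else if i ≤ n + 2 then p i else
      p (n + 2) ⊔ p 1 ⊓ p (n + 3)
  have g₀ : g 0 = p 1 ⊓ p (n + 3) := rfl
  have g₁ : ∀ i, 1 ≤ i → i ≤ n + 2 → g i = p i := fun i h₁ h₂ => by
    simp [g, show i ≠ 0 by omega, h₂]
  have g₂ : g (n + 3) = p (n + 2) ⊔ p 1 ⊓ p (n + 3) := by simp [g]
  refine h (fun i => g (i % (n + 4))) (k + 2)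
    ⟨by omega, fun i => by simp [show 2 * (k + 2) = n + 4 by omega], fun i => ?_⟩
  have hi : i % (n + 4) < n + 4 := Nat.mod_lt _ (by omega)
  change IsTurn (g (i % (n + 4))) (g ((i + 1) % (n + 4))) (g ((i + 2) % (n + 4)))
  rw [← Nat.mod_add_mod i (n + 4) 1, ← Nat.mod_add_mod i (n + 4) 2]
  generalize i % (n + 4) = d at hi
  obtain rfl | ⟨h₁, h₂⟩ | rfl | rfl | rfl :
    d = 0 ∨ (1 ≤ d ∧ d ≤ n) ∨ d = n + 1 ∨ d = n + 2 ∨ d = n + 3 := by omega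
  · rw [Nat.mod_eq_of_lt (by omega), Nat.mod_eq_of_lt (by omega), g₀, g₁ _ (by omega) (by omega),
      g₁ _ (by omega) (by omega)]
    exact t_peak
  · rw [Nat.mod_eq_of_lt (by omega), Nat.mod_eq_of_lt (by omega), g₁ _ (by omega) (by omega),
      g₁ _ (by omega) (by omega), g₁ _ (by omega) (by omega)]
    exact hp.turn (by omega)
  · rw [Nat.mod_eq_of_lt (by omega), Nat.mod_eq_of_lt (by omega), g₁ _ (by omega) (by omega),
      g₁ _ (by omega) (by omega), g₂]
    exact t_sink
  · rw [Nat.mod_eq_of_lt (by omega), show n + 2 + 2 = n + 4 from rfl, Nat.mod_self,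
      g₁ _ (by omega) (by omega), g₂, g₀]
    exact t_last
  · rw [show n + 3 + 1 = n + 4 from rfl, Nat.mod_self, show n + 3 + 2 = 1 + (n + 4) by omega,
      Nat.add_mod_right, Nat.mod_eq_of_lt (by omega), g₂, g₀, g₁ _ (by omega) (by omega)]
    exact t_first

theorem SimplyConnected.not_ge_of_isZigzag (h : SimplyConnected V) {p : ℕ → V} {n : ℕ}
    (hp : IsZigzag p n) (hn : 2 ≤ n) : ¬ p n ≤ p 0 := by
  simpa using h.not_le_of_isZigzag hp.reverse hn

/-- The first term `p 0` of a zigzag can be replaced by two terms `A, A ⊓ p 1`. -/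
theorem IsZigzag.hook {p : ℕ → V} {n : ℕ} (hp : IsZigzag p (n + 1)) {A : V} (h₀ : p 0 ≤ A)
    (hup : p 0 < p 1) (h₁ : ¬ A ≤ p 1) (h₂ : ¬ p 1 ≤ A) :
    ∃ r, IsZigzag r (n + 2) ∧ r 0 = A ∧ r 1 = A ⊓ p 1 ∧ ∀ i, r (i + 2) = p (i + 1) := by
  have s₁ : A ⊓ p 1 < A := inf_lt_left.2 h₁
  have s₂ : A ⊓ p 1 < p 1 := inf_lt_right.2 h₂
  refine ⟨_, (hp.tail.cons (c := A ⊓ p 1) (Or.inl s₂) fun hn => ?_).cons (c := A) (Or.inr s₁)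
    fun _ => Or.inl ⟨s₁, s₂, rfl⟩, rfl, rfl, fun _ => rfl⟩
  obtain ⟨k₁, k₂⟩ := (hp.turn (i := 0) (by omega)).peak_left hup
  exact Or.inr ⟨s₂, k₁, le_antisymm (k₂.le.trans (sup_le_sup_right (le_inf h₀ hup.le) _))
    (sup_le s₂.le k₁.le)⟩

/-- Let `p` be a zigzag starting and ending with lower terms whose inner terms are below `y` and
all satisfy `p s ⊔ w = y`. Then one of the endpoints of `p` also joins with `w` to `y`. -/
theorem SimplyConnected.sup_eq_or (h : SimplyConnected V) {p : ℕ → V} {n : ℕ}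
    (hp : IsZigzag p (n + 2)) {w y : V} (hw : w < y) (h₀ : p 0 < p 1)
    (h₁ : p (n + 2) < p (n + 1))
    (hs : ∀ s, 0 < s → s < n + 2 → p s < y ∧ p s ⊔ w = y) :
    p 0 ⊔ w = y ∨ p (n + 2) ⊔ w = y := by
  by_contra! hne
  obtain ⟨hA, hB⟩ := hne
  have upper : ∀ c s, 0 < s → s < n + 2 → ¬ c ⊔ w ≤ p s := fun c s k₁ k₂ hle =>
    (hs s k₁ k₂).1.ne ((sup_eq_left.2 (le_sup_right.trans hle)).symm.trans (hs s k₁ k₂).2)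
  have lower : ∀ c s, 0 < s → s < n + 2 → c ≤ p s → c ⊔ w ≠ y → ¬ p s ≤ c ⊔ w := by
    intro c s k₁ k₂ hc hcy hle
    refine hcy (le_antisymm (sup_le (hc.trans (hs s k₁ k₂).1.le) hw.le) ?_)
    rw [← (hs s k₁ k₂).2]
    exact sup_le hle le_sup_right
  obtain ⟨r, hr, r₀, r₁, r₂⟩ := hp.hook (A := p 0 ⊔ w) le_sup_left h₀
    (upper _ 1 (by omega) (by omega)) (lower _ 1 (by omega) (by omega) h₀.le hA)
  have rn₁ : r (n + 2) = p (n + 1) := r₂ n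
  have rn₂ : r (n + 3) = p (n + 2) := r₂ (n + 1)
  have e₁ : n + 3 - 1 = n + 2 := rfl
  obtain ⟨t, ht, t₀, -, t₂⟩ := hr.reverse.hook (A := p (n + 2) ⊔ w)
    (by simp only [Nat.sub_zero, rn₂]; exact le_sup_left)
    (by simpa only [Nat.sub_zero, e₁, rn₁, rn₂] using h₁)
    (by simpa only [e₁, rn₁] using upper (p (n + 2)) (n + 1) (by omega) (by omega))
    (by simpa only [e₁, rn₁] using lower _ (n + 1) (by omega) (by omega) h₁.le hB)
  have tn₁ : t (n + 3) = (p 0 ⊔ w) ⊓ p 1 := by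
    rw [t₂ (n + 1), show n + 3 - (n + 1 + 1) = 1 by omega, r₁]
  have tn₂ : t (n + 4) = p 0 ⊔ w := by
    rw [t₂ (n + 2), show n + 3 - (n + 2 + 1) = 0 by omega, r₀]
  have hAB : ¬ p 0 ⊔ w ≤ p (n + 2) ⊔ w := by
    rw [← tn₂, ← t₀]
    exact h.not_ge_of_isZigzag ht (by omega)
  have hwA : w < p 0 ⊔ w := right_lt_sup.2 fun hle => hAB (by
    rw [sup_eq_right.2 hle]; exact le_sup_right)
  have hi : (p 0 ⊔ w) ⊓ p 1 < p 0 ⊔ w := inf_lt_left.2 (upper _ 1 (by omega) (by omega))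
  have z := ht.reverse.cons (c := w) (Or.inl (by simpa only [Nat.sub_zero, tn₂] using hwA))
    fun _ => by
      simp only [Nat.sub_zero, show n + 4 - 1 = n + 3 from rfl, tn₁, tn₂]
      exact Or.inr ⟨hwA, hi, le_antisymm
        (sup_le (le_sup_of_le_right (le_inf le_sup_left h₀.le)) le_sup_left)
        (sup_le hwA.le hi.le)⟩
  refine h.not_le_of_isZigzag z (by omega) ?_
  simp only [consSeq, Nat.sub_self, t₀]
  exact le_sup_right

/-- `T 0, …, T K` is a final segment of a zigzag starting at `a`. -/
def IsFinalSegmentFrom (a : V) (T : ℕ → V) (K : ℕ) : Prop :=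
  ∃ (r : ℕ → V) (l : ℕ), IsZigzag r (l + K) ∧ r 0 = a ∧ ∀ i ≤ K, r (l + i) = T i

theorem IsFinalSegmentFrom.of_dual {a : V} {T : ℕ → V} {K : ℕ}
    (h : IsFinalSegmentFrom (V := Vᵒᵈ) a T K) : IsFinalSegmentFrom a T K := by
  obtain ⟨r, l, hr, h₀, hT⟩ := h
  exact ⟨r, l, hr.dual, h₀, hT⟩

theorem IsZigzag.isFinalSegmentFrom_cons {T : ℕ → V} {K : ℕ} (hT : IsZigzag T K) {c : V}
    (hc : c < T 0 ∨ T 0 < c) (h : 1 ≤ K → IsTurn c (T 0) (T 1)) :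
    IsFinalSegmentFrom c T K := by
  refine ⟨consSeq c T, 1, by rw [add_comm]; exact hT.cons hc h, rfl, fun i _ => ?_⟩
  rw [add_comm]
  rfl

/-- If `p t` is a lower term of a zigzag `p` joining with `T 1` to the peak `T 0`, which is
not below `p (t - 1)`, then `T` is a final segment of a zigzag starting at `p 0`, unless going
back from `t` in `p` below `T 0` one meets a term not joining with `T 1` to `T 0`. -/
theorem IsZigzag.isFinalSegmentFrom_or {T : ℕ → V} {K : ℕ}
    (hT : IsZigzag T K) (hT₁ : T 1 < T 0) {p : ℕ → V} (t : ℕ)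
    (hp : IsZigzag p t) (hlt : p t < T 0) (hsup : p t ⊔ T 1 = T 0)
    (hprev : 1 ≤ t → p t < p (t - 1) ∧ ¬ T 0 ≤ p (t - 1)) :
    IsFinalSegmentFrom (p 0) T K ∨ ∃ i, i + 2 ≤ t ∧ p i < p (i + 1) ∧ p i ⊔ T 1 ≠ T 0 ∧
      ∀ s, i < s → s ≤ t → p s < T 0 ∧ p s ⊔ T 1 = T 0 := by
  have start : ∀ c, c < T 0 → c ⊔ T 1 = T 0 → IsFinalSegmentFrom c T K := fun c hc hc' =>
    hT.isFinalSegmentFrom_cons (Or.inl hc) fun _ => Or.inr ⟨hc, hT₁, hc'.symm⟩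
  induction t using Nat.strong_induction_on with
  | _ t ih =>
  have absorb : ∀ s, p t ≤ s → s ≤ T 0 → s ⊔ T 1 = T 0 := fun s h₁ h₂ =>
    le_antisymm (sup_le h₂ hT₁.le) (hsup ▸ sup_le_sup_right h₁ _)
  rcases t with _ | t
  · exact Or.inl (start _ hlt hsup)
  obtain ⟨hdown, hnle⟩ := hprev (by omega)
  simp only [Nat.add_sub_cancel] at hdown hnle
  by_cases hle : p t ≤ T 0
  · have hlt' : p t < T 0 := lt_of_le_of_ne hle fun e => hnle e.ge
    have hsup' := absorb _ hdown.le hle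
    rcases t with _ | t
    · exact Or.inl (start _ hlt' hsup')
    have hup : p t < p (t + 1) := ((hp.turn le_rfl).peak_right hdown).1
    have extend : ∀ s, t < s → s ≤ t + 2 → p s < T 0 ∧ p s ⊔ T 1 = T 0 := by
      intro s h₁ h₂
      obtain rfl | rfl : s = t + 1 ∨ s = t + 2 := by omega
      exacts [⟨hlt', hsup'⟩, ⟨hlt, hsup⟩]
    by_cases hsup₂ : p t ⊔ T 1 = T 0
    · refine (ih t (by omega) (hp.mono (by omega)) (hup.trans hlt') hsup₂ fun ht => ?_).imp_right
        fun ⟨i, h₁, h₂, h₃, h₄⟩ => ⟨i, by omega, h₂, h₃, fun s k₁ k₂ => ?_⟩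
      · obtain ⟨t, rfl⟩ : ∃ d, t = d + 1 := ⟨t - 1, by omega⟩
        obtain ⟨h₁, h₂⟩ := (hp.turn (i := t) (by omega)).sink_right hup
        exact ⟨h₁, fun h₃ => hup.ne (h₂.trans (inf_eq_right.2 (hle.trans h₃)))⟩
      · exact (le_or_gt s t).elim (h₄ s k₁) fun h => extend s h k₂
    · exact Or.inr ⟨t, le_rfl, hup, hsup₂, extend⟩
  · have s₁ : p t ⊓ T 0 < p t := inf_lt_left.2 hle
    have s₂ : p t ⊓ T 0 < T 0 := inf_lt_right.2 hnle
    have hs : p (t + 1) ≤ p t ⊓ T 0 := le_inf hdown.le hlt.le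
    have z₁ := hT.cons (c := p t ⊓ T 0) (Or.inl s₂) fun _ =>
      Or.inr ⟨s₂, hT₁, (absorb _ hs inf_le_right).symm⟩
    have z₂ := z₁.cons (c := p t) (Or.inr s₁) fun _ => Or.inl ⟨s₁, s₂, rfl⟩
    have z₃ := (hp.mono (Nat.le_succ t)).append z₂ rfl fun ht _ => by
      obtain ⟨t, rfl⟩ : ∃ d, t = d + 1 := ⟨t - 1, by omega⟩
      obtain ⟨h₁, h₂⟩ := (hp.turn le_rfl).peak_right hdown
      exact Or.inr ⟨h₁, s₁, le_antisymm (h₂.le.trans (sup_le_sup_left hs _))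
        (sup_le h₁.le s₁.le)⟩
    refine Or.inl ⟨_, t + 2, by convert z₃ using 1; omega, ?_, fun i _ => ?_⟩
    · rcases t with _ | t <;> simp [consSeq]
    · simp [consSeq, show ¬ t + 2 + i < t by omega, show t + 2 + i - t = i + 1 + 1 by omega]

/-- A zigzag `T` whose first step goes down from a peak `T 0 = x ⊔ T 1` above a term `x` of a
zigzag `p` is a final segment of a zigzag starting at an endpoint of `p`. -/
theorem SimplyConnected.isFinalSegmentFrom_endpoint (h : SimplyConnected V) {T : ℕ → V} {K : ℕ}
    (hT : IsZigzag T K) (hT₁ : T 1 < T 0) {p : ℕ → V} {m j : ℕ}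
    (hp : IsZigzag p m) (hj : j ≤ m) (hlt : p j < T 0) (hsup : p j ⊔ T 1 = T 0) :
    IsFinalSegmentFrom (p 0) T K ∨ IsFinalSegmentFrom (p m) T K := by
  have left := fun t (ht : t ≤ m) => hT.isFinalSegmentFrom_or hT₁ t (hp.mono ht)
  have right : ∀ t ≤ m, p t < T 0 → p t ⊔ T 1 = T 0 →
      (t + 1 ≤ m → p t < p (t + 1) ∧ ¬ T 0 ≤ p (t + 1)) → IsFinalSegmentFrom (p m) T K ∨
      ∃ i, t + 1 ≤ i ∧ i + 1 ≤ m ∧ p (i + 1) < p i ∧ p (i + 1) ⊔ T 1 ≠ T 0 ∧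
        ∀ s, t ≤ s → s ≤ i → p s < T 0 ∧ p s ⊔ T 1 = T 0 := by
    intro t ht h₁ h₂ h₃
    have := hT.isFinalSegmentFrom_or hT₁ (m - t) (hp.reverse.mono (Nat.sub_le m t))
    simp only [Nat.sub_sub_self ht, Nat.sub_zero] at this
    refine (this h₁ h₂ fun h₄ => ?_).imp_right fun ⟨i, k₁, k₂, k₃, k₄⟩ =>
      ⟨m - (i + 1), by omega, by omega, ?_, ?_, fun s l₁ l₂ => ?_⟩
    · rw [show m - (m - t - 1) = t + 1 by omega]
      exact h₃ (by omega)
    · rwa [show m - (i + 1) + 1 = m - i by omega]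
    · rwa [show m - (i + 1) + 1 = m - i by omega]
    · have := k₄ (m - s) (by omega) (by omega)
      rwa [Nat.sub_sub_self (by omega)] at this
  have combine : ∀ i i', i < j → p i < p (i + 1) → p i ⊔ T 1 ≠ T 0 →
      (∀ s, i < s → s ≤ j → p s < T 0 ∧ p s ⊔ T 1 = T 0) → j ≤ i' → i' + 1 ≤ m →
      p (i' + 1) < p i' → p (i' + 1) ⊔ T 1 ≠ T 0 →
      (∀ s, j ≤ s → s ≤ i' → p s < T 0 ∧ p s ⊔ T 1 = T 0) → False := by
    intro i i' h₁ h₂ h₃ h₄ k₁ k₂ k₃ k₄ k₅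
    obtain ⟨n, rfl⟩ : ∃ n, i' = i + (n + 1) := ⟨i' - i - 1, by omega⟩
    exact (h.sup_eq_or ((hp.mono k₂).shift i) hT₁ h₂ k₃ fun s l₁ l₂ =>
      (le_total (i + s) j).elim (h₄ (i + s) (by omega)) fun l => k₅ (i + s) l (by omega)).elim
      h₃ k₄
  rcases j with _ | j
  · exact (left 0 hj hlt hsup (by omega)).imp_right fun ⟨i, hi, _⟩ => by omega
  rcases hj.eq_or_lt with rfl | hjm
  · exact Or.inr ((right _ le_rfl hlt hsup (by omega)).resolve_right fun ⟨i, hi, hi', _⟩ => by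
      omega)
  rcases hp.turn hjm with ⟨h₁, h₂, h₃⟩ | ⟨h₁, h₂, h₃⟩
  · by_cases hle : T 0 ≤ p j
    · refine Or.inr ((right _ hj hlt hsup fun _ => ⟨h₂, fun hle' => ?_⟩).resolve_right ?_)
      · exact hlt.not_ge (h₃ ▸ le_inf hle hle')
      · rintro ⟨i, k₁, -, -, -, k₅⟩
        exact h₂.ne (h₃.trans
          (inf_eq_right.2 ((k₅ (j + 2) (by omega) k₁).1.le.trans hle)))
    · by_cases hle' : T 0 ≤ p (j + 2)
      · refine Or.inl ((left _ hj hlt hsup fun _ => ⟨h₁, hle⟩).resolve_right ?_)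
        rintro ⟨i, k₁, -, -, k₅⟩
        exact h₁.ne (h₃.trans
          (inf_eq_left.2 ((k₅ j (by omega) (by omega)).1.le.trans hle')))
      · rcases left _ hj hlt hsup fun _ => ⟨h₁, hle⟩ with hl | ⟨i, i₁, i₂, i₃, i₄⟩
        · exact Or.inl hl
        rcases right _ hj hlt hsup fun _ => ⟨h₂, hle'⟩ with hr | ⟨i', k₁, k₂, k₃, k₄, k₅⟩
        · exact Or.inr hr
        exact (combine i i' (by omega) i₂ i₃ i₄ (by omega) k₂ k₃ k₄ k₅).elim
  · have hl : IsFinalSegmentFrom (p 0) T K ∨ ∃ i, i < j + 1 ∧ p i < p (i + 1) ∧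
        p i ⊔ T 1 ≠ T 0 ∧ ∀ s, i < s → s ≤ j + 1 → p s < T 0 ∧ p s ⊔ T 1 = T 0 := by
      by_cases hs : p j ⊔ T 1 = T 0
      · refine (left j (by omega) (h₁.trans hlt) hs fun hj₁ => ?_).imp_right
          fun ⟨i, i₁, i₂, i₃, i₄⟩ => ⟨i, by omega, i₂, i₃, fun s k₁ k₂ => ?_⟩
        · obtain ⟨j, rfl⟩ : ∃ d, j = d + 1 := ⟨j - 1, by omega⟩
          obtain ⟨k₁, k₂⟩ := (hp.turn (i := j) (by omega)).sink_right h₁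
          exact ⟨k₁, fun hle => h₁.ne (k₂.trans (inf_eq_right.2 (hlt.le.trans hle)))⟩
        · rcases k₂.eq_or_lt with rfl | k₂
          exacts [⟨hlt, hsup⟩, i₄ s k₁ (by omega)]
      · refine Or.inr ⟨j, by omega, h₁, hs, fun s k₁ k₂ => ?_⟩
        obtain rfl : s = j + 1 := by omega
        exact ⟨hlt, hsup⟩
    have hr : IsFinalSegmentFrom (p m) T K ∨ ∃ i, j + 1 ≤ i ∧ i + 1 ≤ m ∧ p (i + 1) < p i ∧
        p (i + 1) ⊔ T 1 ≠ T 0 ∧ ∀ s, j + 1 ≤ s → s ≤ i → p s < T 0 ∧ p s ⊔ T 1 = T 0 := by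
      by_cases hs : p (j + 2) ⊔ T 1 = T 0
      · refine (right (j + 2) hjm (h₂.trans hlt) hs fun hj₁ => ?_).imp_right
          fun ⟨i, i₁, i₂, i₃, i₄, i₅⟩ => ⟨i, by omega, i₂, i₃, i₄, fun s k₁ k₂ => ?_⟩
        · obtain ⟨k₁, k₂⟩ := (hp.turn (i := j + 1) hj₁).sink_left h₂
          exact ⟨k₁, fun hle => h₂.ne (k₂.trans (inf_eq_left.2 (hlt.le.trans hle)))⟩
        · rcases k₁.eq_or_lt with rfl | k₁
          exacts [⟨hlt, hsup⟩, i₅ s k₁ k₂]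
      · refine Or.inr ⟨j + 1, le_rfl, hjm, h₂, hs, fun s k₁ k₂ => ?_⟩
        obtain rfl : s = j + 1 := by omega
        exact ⟨hlt, hsup⟩
    rcases hl with hl | ⟨i, i₁, i₂, i₃, i₄⟩
    · exact Or.inl hl
    rcases hr with hr | ⟨i', k₁, k₂, k₃, k₄, k₅⟩
    · exact Or.inr hr
    exact (combine i i' i₁ i₂ i₃ i₄ k₁ k₂ k₃ k₄ k₅).elim

theorem isFinalSegmentFrom_zero (a : V) (T : ℕ → V) : IsFinalSegmentFrom a T 0 := by
  have hT : IsZigzag T 0 := ⟨by omega, by omega⟩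
  by_cases h₀ : a = T 0
  · exact ⟨T, 0, hT, h₀.symm, fun i _ => by rw [zero_add]⟩
  by_cases hc : a < T 0 ∨ T 0 < a
  · exact hT.isFinalSegmentFrom_cons hc (by omega)
  have h₁ : a < a ⊔ T 0 := left_lt_sup.2 fun h => hc (Or.inr (lt_of_le_of_ne h (Ne.symm h₀)))
  have h₂ : T 0 < a ⊔ T 0 := right_lt_sup.2 fun h => hc (Or.inl (lt_of_le_of_ne h h₀))
  have z := (hT.cons (Or.inr h₂) (by omega)).cons (c := a) (Or.inl h₁) fun _ =>
    Or.inr ⟨h₁, h₂, rfl⟩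
  refine ⟨_, 2, z, rfl, fun i hi => ?_⟩
  obtain rfl : i = 0 := by omega
  rfl

end Zigzag

/-- (Lemma 4.8) Let `a, …, x, …, b` be a zigzag (`x = p j`) and `x, y, …, c` a zigzag
starting at `x` (of length `k ≥ 1`, with `y = q 1` and `c = q k`).  Then `y, …, c` is
a final segment of a zigzag from `a` to `c` or a final segment of a zigzag from `b`
to `c`. -/
theorem final_segment_of_zigzag {N : ℕ} {M : Type*}
    [Lattice M] [BoundedOrder M] (P : FreePseudospace N M)
    (p : ℕ → M) (m : ℕ) (hp : IsZigzag p m) (j : ℕ) (hj : j ≤ m)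
    (q : ℕ → M) (k : ℕ) (hk : 1 ≤ k) (hq : IsZigzag q k) (hxq : q 0 = p j) :
    ∃ (r : ℕ → M) (l : ℕ), k - 1 ≤ l ∧ IsZigzag r l ∧
      (r 0 = p 0 ∨ r 0 = p m) ∧ r l = q k ∧
      ∀ i ≤ k - 1, r (l - (k - 1) + i) = q (i + 1) := by
  suffices key : IsFinalSegmentFrom (p 0) (fun i => q (i + 1)) (k - 1) ∨
      IsFinalSegmentFrom (p m) (fun i => q (i + 1)) (k - 1) by
    obtain ⟨a, ha, r, l, hr, h₀, hT⟩ : ∃ a, (a = p 0 ∨ a = p m) ∧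
        IsFinalSegmentFrom a (fun i => q (i + 1)) (k - 1) :=
      key.elim (fun h => ⟨_, Or.inl rfl, h⟩) fun h => ⟨_, Or.inr rfl, h⟩
    refine ⟨r, l + (k - 1), by omega, hr, h₀ ▸ ha, ?_, fun i hi => ?_⟩
    · rw [hT _ le_rfl]
      exact congrArg q (Nat.sub_add_cancel hk)
    · rw [Nat.add_sub_cancel]
      exact hT i hi
  obtain ⟨k, rfl⟩ : ∃ d, k = d + 1 := ⟨k - 1, by omega⟩
  rw [Nat.add_sub_cancel]
  rcases k with _ | k
  · exact Or.inl (isFinalSegmentFrom_zero _ _)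
  rcases hq.2 0 (by omega) with ⟨h₁, h₂, h₃⟩ | ⟨h₁, h₂, h₃⟩
  · rw [hxq] at h₁ h₃
    exact (P.simplyConnected.dual.isFinalSegmentFrom_endpoint hq.tail.dual h₂
      hp.dual hj h₁ h₃.symm).imp IsFinalSegmentFrom.of_dual IsFinalSegmentFrom.of_dual
  · rw [hxq] at h₁ h₃
    exact P.simplyConnected.isFinalSegmentFrom_endpoint hq.tail h₂ hp hj h₁ h₃.symm
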